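/- arXiv:2106.04429 — 2 statements merged into one kernel-verified Lean document; each statement's English description precedes it below -/
import Mathlib

section
/- Let P be a convex polytope, let {𝒫_i}_{1≤i≤ℓ} be a conic sequence of the polytopal complex of all faces of P, and let 𝒞 = {C_2, …, C_ℓ} be the corresponding sequence of polytopes. Then the face-number generating function of P satisfies Φ_P(x) = 1 + Σ_{i=2}^{ℓ} (1 + x·Φ_{C_i}(x)) as polynomials in x. -/
open Set Polynomial Metric

/-! ### Polytopes, faces, and conic sequences -/

variable {V : Type*} [NormedAddCommGroup V] [NormedSpace ℝ V]

/-- A (convex) polytope: the convex hull of a finite set. -/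
def IsPolytope (P : Set V) : Prop := ∃ S : Finset V, P = convexHull ℝ (S : Set V)

/-- `F` is a face of the polytope `P` (exposed face; this includes `∅` and `P` itself). -/
def IsFaceOf (F P : Set V) : Prop := IsExposed ℝ P F

/-- The set of all faces of a polytope, i.e. the polytopal complex of all faces of `P`. -/
def faces (P : Set V) : Set (Set V) := {F | IsFaceOf F P}

/-- The dimension of a polytope (the affine dimension of the set). -/
noncomputable def polyDim (s : Set V) : ℕ := Module.finrank ℝ (vectorSpan ℝ s)

/-- The number `f_k(Q)` of `k`-dimensional (nonempty) faces of a polytope `Q`. -/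
noncomputable def faceCount (Q : Set V) (k : ℕ) : ℕ :=
  Nat.card {F : Set V // IsFaceOf F Q ∧ F.Nonempty ∧ polyDim F = k}

/-- The generating function `Φ_Q(x) = ∑_{k=0}^{dim Q} f_k(Q) x^k` of the face numbers. -/
noncomputable def faceGen (Q : Set V) : Polynomial ℚ :=
  ∑ k ∈ Finset.range (polyDim Q + 1), Polynomial.C ((faceCount Q k : ℚ)) * Polynomial.X ^ k

/-- The dimension of a collection of polytopes: the largest dimension of a member. -/
noncomputable def cpxDim (S : Set (Set V)) : ℕ := sSup (polyDim '' S)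

/-- A conic sequence `𝒫 = 𝒫_ℓ, 𝒫_{ℓ-1}, …, 𝒫_1` of a polytopal complex with cell set `K`:
at each step `2 ≤ i ≤ ℓ`, one removes the interval `[v_i, E_i]`, where `v_i` is a cone
vertex of `𝒫_i`, i.e. a vertex such that the subposet `{F ∈ 𝒫_i : v_i ∈ F}` has a unique
maximal (equivalently, greatest) element `E_i`; the sequence ends with `𝒫_1 = {∅, {v_1}}`. -/
structure ConicSeq (K : Set (Set V)) (ℓ : ℕ) where
  cpx : ℕ → Set (Set V)
  v : ℕ → V
  E : ℕ → Set V
  one_le : 1 ≤ ℓ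
  top : cpx ℓ = K
  bottom : cpx 1 = {∅, {v 1}}
  vtx_mem : ∀ i, 2 ≤ i → i ≤ ℓ → {v i} ∈ cpx i
  E_mem : ∀ i, 2 ≤ i → i ≤ ℓ → E i ∈ cpx i
  v_mem_E : ∀ i, 2 ≤ i → i ≤ ℓ → v i ∈ E i
  E_greatest : ∀ i, 2 ≤ i → i ≤ ℓ → ∀ F ∈ cpx i, v i ∈ F → F ⊆ E i
  step : ∀ i, 2 ≤ i → i ≤ ℓ → cpx (i - 1) = cpx i \ {F | F ∈ cpx i ∧ v i ∈ F ∧ F ⊆ E i}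

/-- The interval `[v_i, E_i]` removed at step `i` of a conic sequence. -/
def ConicSeq.interval {K : Set (Set V)} {ℓ : ℕ} (cs : ConicSeq K ℓ) (i : ℕ) : Set (Set V) :=
  {F | F ∈ cs.cpx i ∧ cs.v i ∈ F ∧ F ⊆ cs.E i}

/-- `C` is the intersection of the face `E` with an affine hyperplane separating the cone
vertex `vtx` from `Pprev ∩ E`, where `Pprev` is the geometric realization `P_{i-1}`. -/
def IsConeSlice (C : Set V) (E : Set V) (vtx : V) (Pprev : Set V) : Prop :=
  ∃ (f : V →L[ℝ] ℝ) (c : ℝ), c < f vtx ∧ (∀ x ∈ Pprev ∩ E, f x < c) ∧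
    C = {x ∈ E | f x = c}

/-- `C i` is the cone-slice polytope `C_i` of the conic sequence `cs`, for `2 ≤ i ≤ ℓ`. -/
def ConicSeq.HasSlices {K : Set (Set V)} {ℓ : ℕ} (cs : ConicSeq K ℓ) (C : ℕ → Set V) : Prop :=
  ∀ i, 2 ≤ i → i ≤ ℓ → IsConeSlice (C i) (cs.E i) (cs.v i) (⋃₀ cs.cpx (i - 1))

/-- A simplex: the convex hull of a nonempty affinely independent finite set. -/
def IsSimplex (C : Set V) : Prop :=
  ∃ S : Finset V, S.Nonempty ∧ AffineIndependent ℝ (fun x : {x // x ∈ S} => (x : V)) ∧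
    C = convexHull ℝ (S : Set V)

/-- A polytope combinatorially equivalent to the `d`-dimensional cube `I^d = [0,1]^d`,
i.e. whose face poset is isomorphic to that of `[0,1]^d`. -/
def IsCombCube (C : Set V) (d : ℕ) : Prop :=
  Nonempty ({F : Set V // IsFaceOf F C} ≃o
    {F : Set (Fin d → ℝ) // IsFaceOf F (Set.Icc (0 : Fin d → ℝ) 1)})

/-- A nondegenerate segment (a copy of the interval `I`). -/
def IsSegment (C : Set V) : Prop := ∃ a b : V, a ≠ b ∧ C = segment ℝ a b

/-- A facet: a nonempty face of codimension one. -/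
def IsFacetOf (F P : Set V) : Prop := IsFaceOf F P ∧ F.Nonempty ∧ polyDim F + 1 = polyDim P

/-- A simple polytope: each vertex lies on exactly `dim`-many facets. -/
def IsSimplePolytope (P : Set V) : Prop :=
  IsPolytope P ∧ P.Nonempty ∧
    ∀ w : V, IsFaceOf {w} P → Nat.card {F : Set V // IsFacetOf F P ∧ w ∈ F} = polyDim P

/-! ### Exposed faces of polytopes -/

section Faces

variable {W : Type*} [NormedAddCommGroup W] [NormedSpace ℝ W]

lemma isExposed_level {P : Set W} (l : W →L[ℝ] ℝ) (m : ℝ) (hl : ∀ x ∈ P, l x ≤ m) :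
    IsExposed ℝ P {x ∈ P | l x = m} := by
  rintro ⟨w, hw, hwm⟩
  refine ⟨l, ?_⟩
  ext x
  constructor
  · rintro ⟨hx, hxm⟩
    exact ⟨hx, fun y hy => hxm ▸ hl y hy⟩
  · rintro ⟨hx, h⟩
    exact ⟨hx, le_antisymm (hl x hx) (hwm ▸ h w hw)⟩

lemma IsExposed.exists_level {P F : Set W} (h : IsExposed ℝ P F) {v : W} (hv : v ∈ F) :
    ∃ l : W →L[ℝ] ℝ, (∀ x ∈ P, l x ≤ l v) ∧ F = {x ∈ P | l x = l v} := by
  obtain ⟨l, rfl⟩ := h ⟨v, hv⟩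
  refine ⟨l, hv.2, ?_⟩
  ext x
  constructor
  · rintro ⟨hx, h⟩
    exact ⟨hx, le_antisymm (hv.2 x hx) (h v hv.1)⟩
  · rintro ⟨hx, h⟩
    exact ⟨hx, fun y hy => h ▸ hv.2 y hy⟩

lemma le_on_convexHull {S : Set W} {l : W →L[ℝ] ℝ} {m : ℝ} (hl : ∀ s ∈ S, l s ≤ m) :
    ∀ x ∈ convexHull ℝ S, l x ≤ m :=
  convexHull_min hl (convex_halfSpace_le l.isLinear m)

lemma level_convexHull (S : Finset W) {l : W →L[ℝ] ℝ} {m : ℝ} (hl : ∀ s ∈ S, l s ≤ m) :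
    {x ∈ convexHull ℝ (S : Set W) | l x = m} = convexHull ℝ {s ∈ (S : Set W) | l s = m} := by
  classical
  apply Set.Subset.antisymm
  · rintro x ⟨hx, hxm⟩
    obtain ⟨w, hw0, hw1, rfl⟩ := Finset.mem_convexHull'.1 hx
    have hsum : ∑ s ∈ S, w s * (m - l s) = 0 := by
      simp only [map_sum, map_smul, smul_eq_mul] at hxm
      simp only [mul_sub, Finset.sum_sub_distrib, ← Finset.sum_mul, hw1, hxm]
      ring
    have hz := (Finset.sum_eq_zero_iff_of_nonneg
      (fun s hs => mul_nonneg (hw0 s hs) (sub_nonneg.2 (hl s hs)))).1 hsum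
    have hz' : ∀ s ∈ S, w s ≠ 0 → l s = m := by
      intro s hs hne
      rcases mul_eq_zero.1 (hz s hs) with h | h
      · exact absurd h hne
      · linarith
    have hcoe : {s ∈ (S : Set W) | l s = m} = ((S.filter fun s => l s = m : Finset W) : Set W) := by
      ext; simp
    rw [hcoe, Finset.mem_convexHull']
    refine ⟨w, fun s hs => hw0 s (Finset.mem_filter.1 hs).1, ?_, ?_⟩
    · rw [← hw1]
      exact Finset.sum_filter_of_ne hz'
    · exact Finset.sum_filter_of_ne fun s hs hne => hz' s hs fun h => hne (by rw [h, zero_smul])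
  · apply convexHull_min
    · rintro s ⟨hs, hsm⟩
      exact ⟨subset_convexHull ℝ _ hs, hsm⟩
    · exact (convex_convexHull ℝ _).inter (convex_hyperplane l.isLinear m)

lemma IsExposed.eq_convexHull {S : Finset W} {F : Set W}
    (h : IsExposed ℝ (convexHull ℝ (S : Set W)) F) :
    F = convexHull ℝ ((S : Set W) ∩ F) := by
  rcases F.eq_empty_or_nonempty with rfl | ⟨v, hv⟩
  · simp
  · obtain ⟨l, hl, hF⟩ := h.exists_level hv
    have h1 := level_convexHull S (fun s hs => hl s (subset_convexHull ℝ _ hs))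
    have h2 : (S : Set W) ∩ F = {s ∈ (S : Set W) | l s = l v} := by
      rw [hF]
      ext s
      exact ⟨fun h => ⟨h.1, h.2.2⟩, fun h => ⟨h.1, subset_convexHull ℝ _ h.1, h.2⟩⟩
    rw [h2, ← h1, hF]

lemma finite_faces {P : Set W} (hP : IsPolytope P) : (faces P).Finite := by
  obtain ⟨S, rfl⟩ := hP
  refine Set.Finite.of_finite_image (f := fun F => (S : Set W) ∩ F)
    (S.finite_toSet.finite_subsets.subset ?_) ?_
  · rintro _ ⟨F, -, rfl⟩
    exact Set.inter_subset_left
  · intro F hF G hG h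
    dsimp only at h
    rw [IsExposed.eq_convexHull hF, IsExposed.eq_convexHull hG, h]

lemma IsExposed.trans_polytope {P E F : Set W} (hP : IsPolytope P) (hE : IsExposed ℝ P E)
    (hF : IsExposed ℝ E F) : IsExposed ℝ P F := by
  obtain ⟨S, rfl⟩ := hP
  rcases F.eq_empty_or_nonempty with rfl | ⟨v, hv⟩
  · exact isExposed_empty
  obtain ⟨g, hg, hEg⟩ := hE.exists_level (hF.subset hv)
  obtain ⟨l, hl, hFl⟩ := hF.exists_level hv
  have hS : ∀ s ∈ S, s ∈ convexHull ℝ (S : Set W) := fun s hs => subset_convexHull ℝ _ hs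
  obtain ⟨N, hN⟩ : ∃ N : ℝ, ∀ s ∈ S, g s < g v → l s - l v < N * (g v - g s) := by
    obtain ⟨M, hM⟩ := (S.image fun s => (l s - l v) / (g v - g s)).exists_le
    refine ⟨M + 1, fun s hs h => ?_⟩
    have h1 := hM _ (Finset.mem_image_of_mem _ hs)
    exact (div_lt_iff₀ (by linarith)).1 (by linarith)
  have key : ∀ s ∈ S, (N • g + l) s ≤ (N • g + l) v ∧
      ((N • g + l) s = (N • g + l) v ↔ s ∈ F) := by
    intro s hs
    simp only [add_apply, smul_apply, smul_eq_mul]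
    rcases (hg s (hS s hs)).lt_or_eq with h | h
    · have h1 := hN s hs h
      have h2 : s ∉ F := fun hsF => by
        have := hF.subset hsF
        rw [hEg] at this
        exact h.ne this.2
      refine ⟨by linarith, fun h' => ?_, fun h' => absurd h' h2⟩
      exfalso
      linarith
    · have hsE : s ∈ E := by
        rw [hEg]
        exact ⟨hS s hs, h⟩
      rw [h, hFl]
      refine ⟨by linarith [hl s hsE], fun h' => ⟨hsE, by linarith⟩, fun h' => by rw [h'.2]⟩
  have h1 := level_convexHull S (fun s hs => (key s hs).1)
  have h2 : F = convexHull ℝ ((S : Set W) ∩ F) := by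
    have hE' := hE.eq_convexHull
    classical
    have hcoe : (S : Set W) ∩ E = ((S.filter fun s => s ∈ E : Finset W) : Set W) := by
      ext; simp
    have hF' := hF
    rw [hE', hcoe] at hF'
    have h3 := hF'.eq_convexHull
    rw [← hcoe, Set.inter_assoc, Set.inter_eq_self_of_subset_right hF.subset] at h3
    exact h3
  have h3 : {s ∈ (S : Set W) | (N • g + l) s = (N • g + l) v} = (S : Set W) ∩ F := by
    ext s
    exact and_congr_right fun hs => (key s hs).2
  rw [h2, ← h3, ← h1]
  exact isExposed_level _ _ (le_on_convexHull fun s hs => (key s hs).1)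

lemma exists_vertex_set {P : Set W} (hP : IsPolytope P) :
    ∃ S : Finset W, P = convexHull ℝ (S : Set W) ∧ ∀ s ∈ S, IsExposed ℝ P {s} := by
  classical
  obtain ⟨S₀, h₀⟩ := hP
  obtain ⟨S, hS, hmin⟩ := exists_minimal_of_wellFoundedLT
    (fun S : Finset W => P = convexHull ℝ (S : Set W)) ⟨S₀, h₀⟩
  refine ⟨S, hS, fun s hs => ?_⟩
  have hsub : ((S.erase s : Finset W) : Set W) ⊆ S := by
    exact_mod_cast Finset.erase_subset s S
  have hnot : s ∉ convexHull ℝ ((S.erase s : Finset W) : Set W) := by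
    intro hmem
    have : P = convexHull ℝ ((S.erase s : Finset W) : Set W) := by
      rw [hS]
      apply Set.Subset.antisymm _ (convexHull_mono hsub)
      refine convexHull_min (fun t ht => ?_) (convex_convexHull ℝ _)
      by_cases hts : t = s
      · rwa [hts]
      · exact subset_convexHull ℝ _ (Finset.mem_coe.2 (Finset.mem_erase.2 ⟨hts, ht⟩))
    exact Finset.notMem_erase s S (hmin this (Finset.erase_subset s S) hs)
  obtain ⟨l, u, hlu, hus⟩ := geometric_hahn_banach_closed_point (convex_convexHull ℝ _)
    ((S.erase s).finite_toSet.isClosed_convexHull ℝ) hnot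
  have hlt : ∀ t ∈ S, t ≠ s → l t < l s := fun t ht hts =>
    (hlu t (subset_convexHull ℝ _ (Finset.mem_coe.2 (Finset.mem_erase.2 ⟨hts, ht⟩)))).trans hus
  have hle : ∀ t ∈ S, l t ≤ l s := fun t ht => by
    by_cases hts : t = s
    · rw [hts]
    · exact (hlt t ht hts).le
  have h1 := level_convexHull S hle
  have h2 : {t ∈ (S : Set W) | l t = l s} = {s} := by
    ext t
    constructor
    · rintro ⟨ht, h⟩
      by_contra hts
      exact (hlt t ht hts).ne h
    · rintro rfl
      exact ⟨hs, rfl⟩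
  rw [h2, convexHull_singleton] at h1
  rw [hS, ← h1]
  exact isExposed_level _ _ (le_on_convexHull hle)

lemma IsPolytope.finiteDimensional {P : Set W} (hP : IsPolytope P) :
    FiniteDimensional ℝ (vectorSpan ℝ P) := by
  obtain ⟨S, rfl⟩ := hP
  rw [← direction_affineSpan, affineSpan_convexHull, direction_affineSpan]
  exact finiteDimensional_vectorSpan_of_finite ℝ S.finite_toSet

lemma polyDim_singleton (v : W) : polyDim ({v} : Set W) = 0 := by
  rw [polyDim, vectorSpan_singleton, finrank_bot]

/-- The sum of `X ^ dim F` over the members of a collection of sets. -/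
noncomputable def dimGen (A : Set (Set W)) : Polynomial ℚ :=
  ∑ᶠ F ∈ A, (Polynomial.X : Polynomial ℚ) ^ polyDim F

lemma faceGen_eq_dimGen {Q : Set W} [FiniteDimensional ℝ (vectorSpan ℝ Q)]
    (hfin : {F | IsFaceOf F Q ∧ F.Nonempty}.Finite) :
    faceGen Q = dimGen {F | IsFaceOf F Q ∧ F.Nonempty} := by
  classical
  rw [dimGen, finsum_mem_eq_finite_toFinset_sum _ hfin, faceGen]
  have hmaps : ∀ F ∈ hfin.toFinset, polyDim F ∈ Finset.range (polyDim Q + 1) := by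
    intro F hF
    rw [Set.Finite.mem_toFinset] at hF
    rw [Finset.mem_range, Nat.lt_succ_iff]
    exact Submodule.finrank_mono (vectorSpan_mono ℝ (IsExposed.subset hF.1))
  rw [← Finset.sum_fiberwise_of_maps_to hmaps]
  refine Finset.sum_congr rfl fun k _ => ?_
  rw [Finset.sum_congr rfl (fun F hF => by rw [(Finset.mem_filter.1 hF).2]),
    Finset.sum_const, nsmul_eq_mul, faceCount]
  congr 1
  rw [Nat.subtype_card (hfin.toFinset.filter fun F => polyDim F = k)
    (by intro F; simp [and_assoc])]
  simp

end Faces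

/-! ### Slicing a cone over a vertex -/

section Slice

variable {W : Type*} [NormedAddCommGroup W] [NormedSpace ℝ W]

/-- The central projection from `v` to the hyperplane `f = c`. -/
noncomputable def centralProj (f : W →L[ℝ] ℝ) (c : ℝ) (v x : W) : W :=
  v + ((c - f v) / (f x - f v)) • (x - v)

variable {f : W →L[ℝ] ℝ} {c : ℝ} {v : W} {T : Set W}

lemma centralProj_mem_slice (hT : ∀ t ∈ T, f t < c) (hv : c < f v) {x : W}
    (hx : x ∈ convexHull ℝ (insert v T)) (hxv : x ≠ v) :
    f x < f v ∧ centralProj f c v x ∈ {y ∈ convexHull ℝ (insert v T) | f y = c} := by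
  rcases T.eq_empty_or_nonempty with rfl | hne
  · simp at hx
    exact absurd hx hxv
  rw [convexHull_insert hne, mem_convexJoin] at hx
  obtain ⟨_, rfl, y, hy, hxy⟩ := hx
  have hfy : f y < c := convexHull_min hT (convex_halfSpace_lt f.isLinear c) hy
  rw [segment_eq_image'] at hxy
  obtain ⟨a, ⟨ha0, -⟩, rfl⟩ := hxy
  rename_i v
  have ha : 0 < a := ha0.lt_of_ne (by rintro rfl; simp at hxv)
  have hfx : f (v + a • (y - v)) = f v + a * (f y - f v) := by simp
  have hneg : f y - f v < 0 := by linarith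
  refine ⟨by rw [hfx]; nlinarith, ?_⟩
  have hproj : centralProj f c v (v + a • (y - v)) =
      v + ((f v - c) / (f v - f y)) • (y - v) := by
    rw [centralProj, hfx, add_sub_cancel_left, add_sub_cancel_left, smul_smul]
    congr 2
    rw [← neg_sub (f v) (f y), ← neg_sub (f v) c, mul_neg, neg_div_neg_eq,
      div_mul_eq_mul_div, mul_comm a, mul_div_mul_right _ _ ha.ne']
  have hb0 : 0 ≤ (f v - c) / (f v - f y) := div_nonneg (by linarith) (by linarith)
  have hb1 : (f v - c) / (f v - f y) ≤ 1 := (div_le_one (by linarith)).2 (by linarith)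
  rw [hproj]
  constructor
  · refine (convex_convexHull ℝ _).add_smul_sub_mem (subset_convexHull ℝ _ (mem_insert _ _))
      (convexHull_mono (subset_insert _ _) hy) ⟨hb0, hb1⟩
  · have : f v - f y ≠ 0 := by linarith
    simp only [map_add, map_smul, map_sub, smul_eq_mul]
    field_simp
    ring

lemma centralProj_mem_face_iff (hT : ∀ t ∈ T, f t < c) (hv : c < f v) {F : Set W}
    (hF : IsExposed ℝ (convexHull ℝ (insert v T)) F) (hvF : v ∈ F) {x : W}
    (hx : x ∈ convexHull ℝ (insert v T)) (hxv : x ≠ v) :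
    centralProj f c v x ∈ F ↔ x ∈ F := by
  obtain ⟨l, -, rfl⟩ := hF.exists_level hvF
  obtain ⟨hlt, hmem, -⟩ := centralProj_mem_slice hT hv hx hxv
  have hr : (c - f v) / (f x - f v) ≠ 0 := div_ne_zero (by linarith) (by linarith)
  have : l (centralProj f c v x) = l v + (c - f v) / (f x - f v) * (l x - l v) := by
    simp [centralProj]
  simp only [mem_ofPred_eq, hx, hmem, true_and, this, add_eq_left, mul_eq_zero, hr, false_or,
    sub_eq_zero]

lemma bijOn_slice (hT : ∀ t ∈ T, f t < c) (hv : c < f v) {E : Set W}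
    (hE : E = convexHull ℝ (insert v T)) :
    Set.BijOn (fun F => F ∩ {x | f x = c}) {F | IsExposed ℝ E F ∧ v ∈ F ∧ F ≠ {v}}
      {G | IsExposed ℝ {x ∈ E | f x = c} G ∧ G.Nonempty} := by
  subst hE
  refine ⟨?_, ?_, ?_⟩
  · rintro F ⟨hF, hvF, hne⟩
    constructor
    · obtain ⟨l, hl, hFl⟩ := hF.exists_level hvF
      convert isExposed_level (P := {x ∈ convexHull ℝ (insert v T) | f x = c}) l (l v)
        (fun x hx => hl x hx.1) using 1
      rw [hFl]
      ext x
      simp only [mem_inter_iff, mem_ofPred_eq]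
      tauto
    · obtain ⟨x, hx, hxv⟩ : ∃ x ∈ F, x ≠ v := by
        by_contra! h
        exact hne (Set.Subset.antisymm (fun x hx => h x hx) (by simpa using hvF))
      exact ⟨_, (centralProj_mem_face_iff hT hv hF hvF (hF.subset hx) hxv).2 hx,
        (centralProj_mem_slice hT hv (hF.subset hx) hxv).2.2⟩
  · rintro F ⟨hF, hvF, -⟩ G ⟨hG, hvG, -⟩ h
    dsimp only at h
    ext x
    by_cases hxv : x = v
    · simp [hxv, hvF, hvG]
    by_cases hx : x ∈ convexHull ℝ (insert v T)
    · rw [← centralProj_mem_face_iff hT hv hF hvF hx hxv,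
        ← centralProj_mem_face_iff hT hv hG hvG hx hxv]
      have hc := (centralProj_mem_slice hT hv hx hxv).2.2
      have := Set.ext_iff.1 h (centralProj f c v x)
      simpa [hc] using this
    · exact iff_of_false (fun h => hx (hF.subset h)) (fun h => hx (hG.subset h))
  · rintro G ⟨hG, p, hp⟩
    obtain ⟨g, hg, hGg⟩ := hG.exists_level hp
    have hd : f v - c ≠ 0 := by linarith
    set α : ℝ := (g p - g v) / (f v - c) with hα
    have hαv : α * (f v - c) = g p - g v := div_mul_cancel₀ _ hd
    have hpc : p ∈ {x ∈ convexHull ℝ (insert v T) | f x = c} := hG.subset hp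
    have hvE : v ∈ convexHull ℝ (insert v T) := subset_convexHull ℝ _ (mem_insert _ _)
    have hle : ∀ x ∈ convexHull ℝ (insert v T), (g + α • f) x ≤ (g + α • f) v := by
      intro x hx
      by_cases hxv : x = v
      · rw [hxv]
      obtain ⟨hlt, hmem⟩ := centralProj_mem_slice hT hv hx hxv
      have h1 := hg _ hmem
      have h2 : 0 < (c - f v) / (f x - f v) := div_pos_of_neg_of_neg (by linarith) (by linarith)
      have h3 : (c - f v) / (f x - f v) * (f x - f v) = c - f v :=
        div_mul_cancel₀ _ (by linarith)
      simp only [centralProj, map_add, map_smul, map_sub, smul_eq_mul] at h1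
      simp only [add_apply, smul_apply, smul_eq_mul]
      have h4 : (c - f v) / (f x - f v) * (g x + α * f x - (g v + α * f v)) ≤ 0 := by
        have : (c - f v) / (f x - f v) * (g x + α * f x - (g v + α * f v)) =
          (c - f v) / (f x - f v) * (g x - g v)
            + α * ((c - f v) / (f x - f v) * (f x - f v)) := by ring
        rw [this, h3]
        linarith
      have := nonpos_of_mul_nonpos_right h4 h2
      linarith
    refine ⟨_, ⟨isExposed_level (g + α • f) ((g + α • f) v) hle, ⟨hvE, rfl⟩, ?_⟩, ?_⟩
    · intro h
      have : p ∈ ({v} : Set W) := by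
        rw [← h]
        refine ⟨hpc.1, ?_⟩
        simp only [add_apply, smul_apply, smul_eq_mul,
          hpc.2]
        linarith
      rw [mem_singleton_iff] at this
      rw [← this, hpc.2] at hv
      exact lt_irrefl _ hv
    · rw [hGg]
      ext x
      simp only [add_apply, smul_apply, smul_eq_mul,
        mem_inter_iff, mem_ofPred_eq]
      constructor
      · rintro ⟨⟨hx, h⟩, hc⟩
        rw [hc] at h
        exact ⟨⟨hx, hc⟩, by linarith⟩
      · rintro ⟨⟨hx, hc⟩, h⟩
        refine ⟨⟨hx, ?_⟩, hc⟩
        rw [hc, h]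
        linarith

lemma polyDim_slice (hT : ∀ t ∈ T, f t < c) (hv : c < f v) {F : Set W}
    [FiniteDimensional ℝ (vectorSpan ℝ F)]
    (hF : IsExposed ℝ (convexHull ℝ (insert v T)) F) (hvF : v ∈ F) (hne : F ≠ {v}) :
    polyDim F = polyDim (F ∩ {x | f x = c}) + 1 := by
  obtain ⟨x₀, hx₀F, hx₀v⟩ : ∃ x ∈ F, x ≠ v := by
    by_contra! h
    exact hne (Set.Subset.antisymm (fun x hx => h x hx) (by simpa using hvF))
  have hproj : ∀ x ∈ F, x ≠ v → centralProj f c v x ∈ F ∩ {x | f x = c} := fun x hx hxv =>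
    ⟨(centralProj_mem_face_iff hT hv hF hvF (hF.subset hx) hxv).2 hx,
      (centralProj_mem_slice hT hv (hF.subset hx) hxv).2.2⟩
  set G := F ∩ {x | f x = c} with hG
  set p := centralProj f c v x₀
  have hp : p ∈ G := hproj x₀ hx₀F hx₀v
  have hGle : vectorSpan ℝ G ≤ vectorSpan ℝ F := vectorSpan_mono ℝ Set.inter_subset_left
  have hker : vectorSpan ℝ G ≤ LinearMap.ker (f : W →ₗ[ℝ] ℝ) := by
    rw [vectorSpan_eq_span_vsub_set_right ℝ hp, Submodule.span_le]
    rintro _ ⟨y, hy, rfl⟩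
    have h1 : f y = c := hy.2
    have h2 : f p = c := hp.2
    simp [h1, h2]
  have hfp : f (p - v) ≠ 0 := by
    have h2 : f p = c := hp.2
    rw [map_sub, h2]
    linarith
  have hsup : vectorSpan ℝ F = vectorSpan ℝ G ⊔ Submodule.span ℝ {p - v} := by
    apply le_antisymm
    · rw [vectorSpan_eq_span_vsub_set_right ℝ hvF, Submodule.span_le]
      rintro _ ⟨x, hx, rfl⟩
      by_cases hxv : x = v
      · simp [hxv]
      have hlt := (centralProj_mem_slice hT hv (hF.subset hx) hxv).1
      have hr : (c - f v) / (f x - f v) ≠ 0 := div_ne_zero (by linarith) (by linarith)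
      have heq : x - v = ((c - f v) / (f x - f v))⁻¹ •
          ((centralProj f c v x - p) + (p - v)) := by
        rw [sub_add_sub_cancel, centralProj, add_sub_cancel_left, inv_smul_smul₀ hr]
      simp only [vsub_eq_sub, SetLike.mem_coe]
      rw [heq]
      exact Submodule.smul_mem _ _ (Submodule.add_mem_sup
        (vsub_mem_vectorSpan ℝ (hproj x hx hxv) hp) (Submodule.mem_span_singleton_self _))
    · refine sup_le hGle ?_
      rw [Submodule.span_singleton_le_iff_mem]
      exact vsub_mem_vectorSpan ℝ hp.1 hvF
  have hinf : vectorSpan ℝ G ⊓ Submodule.span ℝ {p - v} = ⊥ := by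
    rw [eq_bot_iff]
    rintro z ⟨hz1, hz2⟩
    obtain ⟨a, rfl⟩ := Submodule.mem_span_singleton.1 hz2
    have : f (a • (p - v)) = 0 := hker hz1
    rw [map_smul, smul_eq_mul] at this
    rcases mul_eq_zero.1 this with h | h
    · simp [h]
    · exact absurd h hfp
  have : FiniteDimensional ℝ (vectorSpan ℝ G) := Submodule.finiteDimensional_of_le hGle
  have hdim := Submodule.finrank_sup_add_finrank_inf_eq (vectorSpan ℝ G)
    (Submodule.span ℝ {p - v})
  rw [hinf, finrank_bot, add_zero, ← hsup,
    finrank_span_singleton (fun h => hfp (by rw [h, map_zero]))] at hdim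
  exact hdim

lemma dimGen_vertex_star (hT : ∀ t ∈ T, f t < c) (hv : c < f v) {E : Set W}
    (hE : E = convexHull ℝ (insert v T)) (hpoly : IsPolytope E) (hvE : IsExposed ℝ E {v}) :
    dimGen {F | IsExposed ℝ E F ∧ v ∈ F} =
      1 + Polynomial.X * faceGen {x ∈ E | f x = c} := by
  have hfin : {F | IsExposed ℝ E F ∧ v ∈ F ∧ F ≠ {v}}.Finite :=
    (finite_faces hpoly).subset fun F hF => hF.1
  have hbij := bijOn_slice hT hv hE
  have hfinC : {G | IsExposed ℝ {x ∈ E | f x = c} G ∧ G.Nonempty}.Finite :=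
    hbij.image_eq ▸ hfin.image _
  have := hpoly.finiteDimensional
  have : FiniteDimensional ℝ (vectorSpan ℝ {x ∈ E | f x = c}) :=
    Submodule.finiteDimensional_of_le (vectorSpan_mono ℝ fun x hx => hx.1)
  have hsplit : {F | IsExposed ℝ E F ∧ v ∈ F} =
      insert {v} {F | IsExposed ℝ E F ∧ v ∈ F ∧ F ≠ {v}} := by
    ext F
    by_cases h : F = {v}
    · simp [h, hvE]
    · simp [h]
  rw [faceGen_eq_dimGen hfinC, hsplit, dimGen, finsum_mem_insert _ (by simp) hfin, dimGen,
    mul_finsum_mem]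
  congr 1
  · rw [polyDim_singleton, pow_zero]
  · refine finsum_mem_eq_of_bijOn _ hbij fun F hF => ?_
    have : FiniteDimensional ℝ (vectorSpan ℝ F) :=
      Submodule.finiteDimensional_of_le (vectorSpan_mono ℝ (IsExposed.subset hF.1))
    rw [polyDim_slice hT hv (hE ▸ hF.1) hF.2.1 hF.2.2, pow_succ']

end Slice

/-! ### Conic sequences -/

section Conic

lemma ConicSeq.mem_pred_iff {U : Type*} {K : Set (Set U)} {ℓ : ℕ} (cs : ConicSeq K ℓ) {i : ℕ} (h2 : 2 ≤ i)
    (hi : i ≤ ℓ) {F : Set U} : F ∈ cs.cpx (i - 1) ↔ F ∈ cs.cpx i ∧ cs.v i ∉ F := by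
  rw [cs.step i h2 hi]
  constructor
  · rintro ⟨h, h'⟩
    exact ⟨h, fun hv => h' ⟨h, hv, cs.E_greatest i h2 hi F h hv⟩⟩
  · rintro ⟨h, h'⟩
    exact ⟨h, fun hv => h' hv.2.1⟩

variable {W : Type*} [NormedAddCommGroup W] [NormedSpace ℝ W] {P : Set W} {ℓ : ℕ}

lemma ConicSeq.cpx_subset_and_down_closed (cs : ConicSeq (faces P) ℓ) {i : ℕ} (h1 : 1 ≤ i)
    (hi : i ≤ ℓ) : cs.cpx i ⊆ faces P ∧
      ∀ E ∈ cs.cpx i, ∀ F ∈ faces P, F ⊆ E → F ∈ cs.cpx i := by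
  induction hi using Nat.decreasingInduction with
  | self => exact ⟨cs.top.le, fun E _ F hF _ => cs.top.ge hF⟩
  | of_succ k hk ih =>
    obtain ⟨ih1, ih2⟩ := ih (by omega)
    have hiff := fun F => cs.mem_pred_iff (i := k + 1) (by omega) hk (F := F)
    simp only [Nat.add_sub_cancel] at hiff
    refine ⟨fun F hF => ih1 ((hiff F).1 hF).1, fun E hE F hF hFE => ?_⟩
    obtain ⟨hE1, hE2⟩ := (hiff E).1 hE
    exact (hiff F).2 ⟨ih2 E hE1 F hF hFE, fun h => hE2 (hFE h)⟩

lemma ConicSeq.dimGen_star (hP : IsPolytope P) (cs : ConicSeq (faces P) ℓ) {C : ℕ → Set W}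
    (hC : cs.HasSlices C) {i : ℕ} (h2 : 2 ≤ i) (hi : i ≤ ℓ) :
    dimGen {F | F ∈ cs.cpx i ∧ cs.v i ∈ F} = 1 + Polynomial.X * faceGen (C i) := by
  classical
  obtain ⟨hsub, hdown⟩ := cs.cpx_subset_and_down_closed (by omega) hi
  have hE := cs.E_mem i h2 hi
  have hvE := cs.v_mem_E i h2 hi
  have hvP : IsExposed ℝ P {cs.v i} := hsub (cs.vtx_mem i h2 hi)
  have hEP : IsExposed ℝ P (cs.E i) := hsub hE
  obtain ⟨S, hS, hvert⟩ := exists_vertex_set hP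
  have hES : cs.E i = convexHull ℝ ((S : Set W) ∩ cs.E i) := by
    have hES' := hEP
    rw [congrFun (congrArg (IsExposed ℝ) hS) (cs.E i)] at hES'
    exact hES'.eq_convexHull
  have hpoly : IsPolytope (cs.E i) := ⟨S.filter (· ∈ cs.E i), by
    rw [Finset.coe_filter]; exact hES⟩
  obtain ⟨f, c, hv, hlt, hCi⟩ := hC i h2 hi
  have hT : ∀ t ∈ ((S : Set W) ∩ cs.E i) \ {cs.v i}, f t < c := by
    rintro t ⟨⟨htS, htE⟩, htv⟩
    refine hlt t ⟨⟨{t}, ?_, rfl⟩, htE⟩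
    refine (cs.mem_pred_iff h2 hi).2
      ⟨hdown _ hE _ (hvert t htS) (Set.singleton_subset_iff.2 htE), fun h => htv ?_⟩
    exact (mem_singleton_iff.1 h).symm
  have hET : cs.E i = convexHull ℝ (insert (cs.v i) (((S : Set W) ∩ cs.E i) \ {cs.v i})) := by
    rw [Set.insert_sdiff_singleton]
    apply Set.Subset.antisymm
    · conv_lhs => rw [hES]
      exact convexHull_mono (subset_insert _ _)
    · refine convexHull_min (insert_subset hvE Set.inter_subset_right) ?_
      rw [hES]
      exact convex_convexHull ℝ _
  have hset : {F | F ∈ cs.cpx i ∧ cs.v i ∈ F} =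
      {F | IsExposed ℝ (cs.E i) F ∧ cs.v i ∈ F} := by
    ext F
    constructor
    · rintro ⟨hF, hvF⟩
      exact ⟨IsExposed.mono (hsub hF) hEP.subset (cs.E_greatest i h2 hi F hF hvF), hvF⟩
    · rintro ⟨hF, hvF⟩
      exact ⟨hdown _ hE _ (hEP.trans_polytope hP hF) hF.subset, hvF⟩
  rw [hset, hCi]
  exact dimGen_vertex_star hT hv hET hpoly
    (hvP.mono hEP.subset (Set.singleton_subset_iff.2 hvE))

lemma ConicSeq.dimGen_cpx (hP : IsPolytope P) (cs : ConicSeq (faces P) ℓ) {C : ℕ → Set W}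
    (hC : cs.HasSlices C) {i : ℕ} (h1 : 1 ≤ i) (hi : i ≤ ℓ) :
    dimGen {F | F ∈ cs.cpx i ∧ F.Nonempty} =
      1 + ∑ j ∈ Finset.Icc 2 i, (1 + Polynomial.X * faceGen (C j)) := by
  induction i, h1 using Nat.le_induction with
  | base =>
    have : {F : Set W | F ∈ cs.cpx 1 ∧ F.Nonempty} = {{cs.v 1}} := by
      rw [cs.bottom]
      ext F
      constructor
      · rintro ⟨rfl | rfl, h⟩
        · exact absurd h Set.not_nonempty_empty
        · rfl
      · rintro rfl
        exact ⟨Or.inr rfl, Set.singleton_nonempty _⟩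
    rw [this, dimGen, finsum_mem_singleton, polyDim_singleton]
    simp
  | succ n hn ih =>
    have hfin : (cs.cpx (n + 1)).Finite :=
      (finite_faces hP).subset (cs.cpx_subset_and_down_closed (by omega) hi).1
    have hiff := fun F => cs.mem_pred_iff (i := n + 1) (by omega) hi (F := F)
    simp only [Nat.add_sub_cancel] at hiff
    have hset : {F | F ∈ cs.cpx (n + 1) ∧ F.Nonempty} =
        {F | F ∈ cs.cpx n ∧ F.Nonempty} ∪ {F | F ∈ cs.cpx (n + 1) ∧ cs.v (n + 1) ∈ F} := by
      ext F
      simp only [mem_ofPred_eq, mem_union, hiff]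
      have : cs.v (n + 1) ∈ F → F.Nonempty := fun h => ⟨_, h⟩
      tauto
    have hdisj : Disjoint {F | F ∈ cs.cpx n ∧ F.Nonempty}
        {F | F ∈ cs.cpx (n + 1) ∧ cs.v (n + 1) ∈ F} :=
      Set.disjoint_left.2 fun F hF hF' => ((hiff F).1 hF.1).2 hF'.2
    rw [hset, dimGen, finsum_mem_union hdisj
      (hfin.subset fun F hF => ((hiff F).1 hF.1).1) (hfin.subset fun F hF => hF.1)]
    change dimGen _ + dimGen _ = _
    rw [ih (by omega), cs.dimGen_star hP hC (by omega) hi,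
      Finset.sum_Icc_succ_top (by omega), add_assoc]

end Conic

/-- **Proposition 2.5.** If `{𝒫_i}_{1 ≤ i ≤ ℓ}` is a conic sequence of the polytopal complex
of all faces of a convex polytope `P`, with corresponding sequence of polytopes
`𝒞 = {C_2, …, C_ℓ}`, then `Φ_P(x) = 1 + ∑_{i=2}^{ℓ} (1 + x·Φ_{C_i}(x))`. -/
theorem conic_sequence_face_generating_function
    {V : Type*} [NormedAddCommGroup V] [NormedSpace ℝ V]
    (P : Set V) (hP : IsPolytope P) (ℓ : ℕ) (cs : ConicSeq (faces P) ℓ)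
    (C : ℕ → Set V) (hC : cs.HasSlices C) :
    faceGen P = 1 + ∑ i ∈ Finset.Icc 2 ℓ, (1 + Polynomial.X * faceGen (C i)) := by
  have hfin : {F | IsFaceOf F P ∧ F.Nonempty}.Finite :=
    (finite_faces hP).subset fun F hF => hF.1
  have := hP.finiteDimensional
  rw [faceGen_eq_dimGen hfin, ← cs.dimGen_cpx hP hC cs.one_le le_rfl, cs.top]
  rfl
end

section
/- Let P be an n-dimensional convex polytope admitting a Δ-conic sequence with corresponding sequence of simplices 𝒞 = {C_2, …, C_ℓ}. Define integers h_0, …, h_n by the identity Σ_{k=0}^n f_k(P) x^k = Σ_{k=0}^n h_k (x+1)^k. Then h_0 = 1, for each 1 ≤ k ≤ n the number h_k equals the number of (k−1)-dimensional simplices among C_2, …, C_ℓ, and h_k ≥ 1 for all 1 ≤ k ≤ n. -/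
open Set Polynomial Metric

/-! ### Polytopes, faces, and conic sequences -/

variable {V : Type*} [NormedAddCommGroup V] [NormedSpace ℝ V]

/-- A finitely supported prescription of values on a linearly independent family is realized by a
continuous linear functional. -/
lemma exists_continuousLinearMap_of_linearIndepOn {S : Finset V} {p : V → V}
    (hp : LinearIndepOn ℝ p (S : Set V)) (b : V → ℝ) :
    ∃ g : V →L[ℝ] ℝ, ∀ u ∈ S, g (p u) = b u := by
  have : FiniteDimensional ℝ (Submodule.span ℝ (Set.range fun u : (S : Set V) => p u)) :=
    FiniteDimensional.span_of_finite ℝ (Set.finite_range _)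
  have hp' : LinearIndependent ℝ fun u : (S : Set V) => p u := hp
  obtain ⟨g, hg, -⟩ := exists_extension_norm_eq (𝕜 := ℝ)
    (Submodule.span ℝ (Set.range fun u : (S : Set V) => p u))
    (((Module.Basis.span hp').constr ℝ fun u : (S : Set V) => b u).toContinuousLinearMap)
  refine ⟨g, fun u hu => ?_⟩
  have h1 := hg ((Module.Basis.span hp') ⟨u, hu⟩)
  rw [LinearMap.coe_toContinuousLinearMap', Module.Basis.constr_basis,
    Module.Basis.span_apply] at h1
  exact h1

/-- A point outside a finitely generated subspace is separated from it by a continuous linear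
functional. -/
lemma exists_continuousLinearMap_pos_of_notMem {W : Submodule ℝ V} [FiniteDimensional ℝ W] {x : V}
    (hx : x ∉ W) : ∃ g : V →L[ℝ] ℝ, 0 < g x ∧ ∀ y ∈ W, g y = 0 := by
  obtain ⟨g, c, hg, hc⟩ := geometric_hahn_banach_closed_point W.convex
    W.closed_of_finiteDimensional hx
  have h0 : 0 < c := by simpa using hg 0 W.zero_mem
  refine ⟨g, h0.trans hc, fun y hy => ?_⟩
  by_contra hne
  have h1 := hg ((c / g y) • y) (W.smul_mem _ hy)
  rw [map_smul, smul_eq_mul, div_mul_cancel₀ _ hne] at h1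
  exact lt_irrefl _ h1

lemma le_of_mem_convexHull {S : Set V} {g : V →L[ℝ] ℝ} {m : ℝ} (hg : ∀ s ∈ S, g s ≤ m) {x : V}
    (hx : x ∈ convexHull ℝ S) : g x ≤ m :=
  convexHull_min (t := {y | g y ≤ m}) hg (convex_halfSpace_le g.toLinearMap.isLinear m) hx

/-- A point of a polytope where a functional is maximal is a convex combination of generators
where it is maximal. -/
lemma mem_convexHull_filter_of_eq {S : Finset V} {g : V →L[ℝ] ℝ} {m : ℝ}
    (hg : ∀ s ∈ S, g s ≤ m) {x : V} (hx : x ∈ convexHull ℝ (S : Set V)) (hxm : g x = m) :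
    x ∈ convexHull ℝ {s | s ∈ S ∧ g s = m} := by
  classical
  obtain ⟨w, hw0, hw1, hwx⟩ := Finset.mem_convexHull'.1 hx
  have hsum : ∑ s ∈ S, w s * (m - g s) = 0 := by
    have : g x = ∑ s ∈ S, w s * g s := by rw [← hwx]; simp [map_sum]
    simp only [mul_sub, Finset.sum_sub_distrib, ← Finset.sum_mul, hw1]
    rw [← this, hxm]; ring
  have hz := (Finset.sum_eq_zero_iff_of_nonneg fun s hs =>
    mul_nonneg (hw0 s hs) (sub_nonneg.2 (hg s hs))).1 hsum
  have hz' : ∀ s ∈ S, w s ≠ 0 → g s = m := fun s hs hne => by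
    have := (mul_eq_zero.1 (hz s hs)).resolve_left hne
    linarith
  have key : x ∈ convexHull ℝ ((S.filter fun s => g s = m : Finset V) : Set V) := by
    refine Finset.mem_convexHull'.2 ⟨w, fun s hs => hw0 s (Finset.mem_filter.1 hs).1, ?_, ?_⟩
    · rw [Finset.sum_filter_of_ne fun s hs hne => hz' s hs hne]; exact hw1
    · rw [Finset.sum_filter_of_ne fun s hs hne => hz' s hs fun h0 => hne (by simp [h0])]
      exact hwx
  simpa [Finset.coe_filter] using key

lemma isExposed_setOf_eq {E : Set V} {g : V →L[ℝ] ℝ} {m : ℝ} (hg : ∀ x ∈ E, g x ≤ m) :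
    IsExposed ℝ E {x | x ∈ E ∧ g x = m} := by
  rintro ⟨p, hp, hpm⟩
  refine ⟨g, Set.ext fun x => ⟨fun hx => ⟨hx.1, fun y hy => (hg y hy).trans_eq hx.2.symm⟩,
    fun hx => ⟨hx.1, le_antisymm (hg x hx.1) (hpm ▸ hx.2 p hp)⟩⟩⟩

lemma IsExposed.exists_max {E F : Set V} (hF : IsExposed ℝ E F) {p : V} (hp : p ∈ F) :
    ∃ g : V →L[ℝ] ℝ, (∀ x ∈ E, g x ≤ g p) ∧ F = {x | x ∈ E ∧ g x = g p} := by
  obtain ⟨g, rfl⟩ := hF ⟨p, hp⟩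
  exact ⟨g, hp.2, Set.ext fun x => ⟨fun hx => ⟨hx.1, le_antisymm (hp.2 x hx.1) (hx.2 p hp.1)⟩,
    fun hx => ⟨hx.1, fun y hy => (hp.2 y hy).trans_eq hx.2.symm⟩⟩⟩

/-- A polytope is the convex hull of finitely many exposed points. -/
lemma exists_exposed_generators (S : Finset V) : ∃ T : Finset V,
    convexHull ℝ (S : Set V) = convexHull ℝ (T : Set V) ∧
      ∀ t ∈ T, IsExposed ℝ (convexHull ℝ (T : Set V)) {t} := by
  classical
  induction S using Finset.strongInduction with
  | H S ih =>
    by_cases hS : ∃ s ∈ S, s ∈ convexHull ℝ ((S.erase s : Finset V) : Set V)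
    · obtain ⟨s, hs, hsc⟩ := hS
      obtain ⟨T, hT, hTe⟩ := ih _ (Finset.erase_ssubset hs)
      refine ⟨T, ?_, hTe⟩
      rw [← hT]
      refine Set.Subset.antisymm (convexHull_min (fun t ht => ?_) (convex_convexHull ℝ _))
        (convexHull_mono (Finset.coe_subset.2 (Finset.erase_subset _ _)))
      by_cases hts : t = s
      · exact hts ▸ hsc
      · exact subset_convexHull ℝ _ (Finset.mem_coe.2 (Finset.mem_erase.2 ⟨hts, ht⟩))
    · push Not at hS
      refine ⟨S, rfl, fun t ht => ?_⟩
      obtain ⟨g, c, hg, hc⟩ := geometric_hahn_banach_closed_point (convex_convexHull ℝ _)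
        ((S.erase t).finite_toSet.isClosed_convexHull ℝ) (hS t ht)
      have hlt : ∀ s ∈ S, s ≠ t → g s < g t := fun s hs hst =>
        (hg s (subset_convexHull ℝ _ (Finset.mem_coe.2 (Finset.mem_erase.2 ⟨hst, hs⟩)))).trans hc
      have hle : ∀ s ∈ S, g s ≤ g t := fun s hs => by
        by_cases hst : s = t
        · rw [hst]
        · exact (hlt s hs hst).le
      have : ({t} : Set V) = {x | x ∈ convexHull ℝ (S : Set V) ∧ g x = g t} := by
        refine Set.Subset.antisymm ?_ fun x hx => ?_
        · rintro x rfl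
          exact ⟨subset_convexHull ℝ _ ht, rfl⟩
        · have := mem_convexHull_filter_of_eq hle hx.1 hx.2
          rw [← convexHull_singleton (𝕜 := ℝ) t]
          refine convexHull_mono (fun s hs => ?_) this
          by_contra hst
          exact (hlt s hs.1 hst).ne hs.2
      rw [this]
      exact isExposed_setOf_eq fun x hx => le_of_mem_convexHull hle hx

/-- A face of a polytope is the convex hull of the generators it contains. -/
lemma IsExposed.eq_convexHull_s3 {S : Finset V} {F : Set V}
    (hF : IsExposed ℝ (convexHull ℝ (S : Set V)) F) (hne : F.Nonempty) :
    F = convexHull ℝ {s | s ∈ S ∧ s ∈ F} := by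
  obtain ⟨p, hp⟩ := hne
  refine Set.Subset.antisymm (fun x hx => ?_)
    (convexHull_min (fun s hs => hs.2) (hF.convex (convex_convexHull ℝ _)))
  obtain ⟨g, hg, hFg⟩ := hF.exists_max hp
  rw [hFg] at hx
  have hmem := mem_convexHull_filter_of_eq
    (fun s hs => hg s (subset_convexHull ℝ _ hs)) hx.1 hx.2
  refine convexHull_mono ?_ hmem
  rintro s hs
  refine ⟨hs.1, ?_⟩
  rw [hFg]
  exact ⟨subset_convexHull ℝ _ hs.1, hs.2⟩

/-- A face of a face of a polytope is a face of the polytope. -/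
lemma IsExposed.trans_of_convexHull {S : Finset V} {E F : Set V}
    (hE : IsExposed ℝ (convexHull ℝ (S : Set V)) E) (hF : IsExposed ℝ E F) :
    IsExposed ℝ (convexHull ℝ (S : Set V)) F := by
  intro hne
  obtain ⟨p, hp⟩ := id hne
  have hpE : p ∈ E := hF.subset hp
  obtain ⟨l, hl, hEl⟩ := hE.exists_max hpE
  obtain ⟨g, hg, hFg⟩ := hF.exists_max hp
  have hmem : ∀ s ∈ S, s ∈ convexHull ℝ (S : Set V) := fun s hs => subset_convexHull ℝ _ hs
  have hK : ∃ K : ℝ, ∀ s ∈ S, l s < l p → g s - g p < K * (l p - l s) := by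
    obtain ⟨K, hK⟩ := (S.image fun s => (g s - g p) / (l p - l s)).bddAbove
    refine ⟨K + 1, fun s hs hlt => ?_⟩
    rw [← div_lt_iff₀ (sub_pos.2 hlt)]
    have := hK (Finset.mem_coe.2 (Finset.mem_image_of_mem _ hs))
    linarith
  obtain ⟨K, hK⟩ := hK
  have hS : ∀ s ∈ S, (K • l + g) s ≤ (K • l + g) p ∧
      ((K • l + g) s = (K • l + g) p → s ∈ F) := by
    intro s hs
    simp only [_root_.add_apply, _root_.smul_apply, smul_eq_mul]
    rcases (hl s (hmem s hs)).lt_or_eq with hlt | heq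
    · have := hK s hs hlt
      exact ⟨by linarith, fun h => by linarith⟩
    · have hsE : s ∈ E := by rw [hEl]; exact ⟨hmem s hs, heq⟩
      rw [heq]
      refine ⟨by linarith [hg s hsE], fun h => ?_⟩
      rw [hFg]
      exact ⟨hsE, by linarith⟩
  have hFeq : F = {x | x ∈ convexHull ℝ (S : Set V) ∧ (K • l + g) x = (K • l + g) p} := by
    refine Set.Subset.antisymm (fun x hx => ?_) fun x hx => ?_
    · have hxE := hF.subset hx
      refine ⟨hE.subset hxE, ?_⟩
      rw [hFg] at hx
      rw [hEl] at hxE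
      simp [hx.2, hxE.2]
    · refine convexHull_min (fun s hs => (hS s hs.1).2 hs.2)
        (hF.convex (hE.convex (convex_convexHull ℝ _)))
        (mem_convexHull_filter_of_eq (fun s hs => (hS s hs).1) hx.1 hx.2)
  exact (hFeq ▸ isExposed_setOf_eq
    (fun x hx => le_of_mem_convexHull (fun s hs => (hS s hs).1) hx)) hne

lemma finiteDimensional_vectorSpan_convexHull (S : Finset V) :
    FiniteDimensional ℝ (vectorSpan ℝ (convexHull ℝ (S : Set V))) := by
  rw [← direction_affineSpan, affineSpan_convexHull, direction_affineSpan]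
  exact finiteDimensional_vectorSpan_of_finite ℝ S.finite_toSet

lemma polyDim_mono {A : Set V} {S : Finset V} (h : A ⊆ convexHull ℝ (S : Set V)) :
    polyDim A ≤ polyDim (convexHull ℝ (S : Set V)) := by
  have := finiteDimensional_vectorSpan_convexHull S
  exact Submodule.finrank_mono (vectorSpan_mono ℝ h)

lemma polyDim_empty : polyDim (∅ : Set V) = 0 := by
  rw [polyDim, vectorSpan_empty, finrank_bot]

lemma polyDim_singleton_s3 (x : V) : polyDim ({x} : Set V) = 0 := by simp [polyDim]

/-- A functional bounded by `1` on `T - v` whose contact set spans the same subspace as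
`T - v`. -/
lemma exists_functional_tight_span (T : Finset V) (v : V) : ∃ g : V →L[ℝ] ℝ,
    (∀ t ∈ T, g (t - v) ≤ 1) ∧
      ∀ t ∈ T, t - v ∈ Submodule.span ℝ ((· - v) '' {s | s ∈ T ∧ g (s - v) = 1}) := by
  classical
  suffices H : ∀ (k : ℕ) (g : V →L[ℝ] ℝ), (∀ t ∈ T, g (t - v) ≤ 1) →
      (T.filter fun t => g (t - v) ≠ 1).card = k → ∃ g : V →L[ℝ] ℝ, (∀ t ∈ T, g (t - v) ≤ 1) ∧
      ∀ t ∈ T, t - v ∈ Submodule.span ℝ ((· - v) '' {s | s ∈ T ∧ g (s - v) = 1}) from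
    H _ 0 (fun t _ => by simp) rfl
  intro k
  induction k using Nat.strong_induction_on with
  | _ k ih =>
    intro g hg hk
    by_cases hall : ∀ t ∈ T,
        t - v ∈ Submodule.span ℝ ((· - v) '' {s | s ∈ T ∧ g (s - v) = 1})
    · exact ⟨g, hg, hall⟩
    push Not at hall
    obtain ⟨t₀, ht₀, hnot⟩ := hall
    have : FiniteDimensional ℝ
        (Submodule.span ℝ ((· - v) '' {s | s ∈ T ∧ g (s - v) = 1})) :=
      FiniteDimensional.span_of_finite ℝ ((T.finite_toSet.subset fun s hs => hs.1).image _)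
    obtain ⟨h, hpos, hzero⟩ := exists_continuousLinearMap_pos_of_notMem hnot
    have htight : ∀ t ∈ T, g (t - v) = 1 → h (t - v) = 0 := fun t ht h1 =>
      hzero _ (Submodule.subset_span ⟨t, ⟨ht, h1⟩, rfl⟩)
    obtain ⟨t₁, ht₁, hmin⟩ := Finset.exists_min_image (T.filter fun t => 0 < h (t - v))
      (fun t => (1 - g (t - v)) / h (t - v)) ⟨t₀, Finset.mem_filter.2 ⟨ht₀, hpos⟩⟩
    obtain ⟨ht₁T, ht₁pos⟩ := Finset.mem_filter.1 ht₁
    set ε := (1 - g (t₁ - v)) / h (t₁ - v) with hε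
    have hε0 : 0 ≤ ε := div_nonneg (sub_nonneg.2 (hg _ ht₁T)) ht₁pos.le
    have hval : ∀ x, (g + ε • h) x = g x + ε * h x := fun x => by simp
    refine ih _ ?_ (g + ε • h) (fun t ht => ?_) rfl
    · rw [← hk]
      refine Finset.card_lt_card ((Finset.ssubset_iff_of_subset fun t ht => ?_).2 ⟨t₁, ?_, ?_⟩)
      · rw [Finset.mem_filter] at ht ⊢
        refine ⟨ht.1, fun h1 => ht.2 ?_⟩
        rw [hval, h1, htight t ht.1 h1]; ring
      · exact Finset.mem_filter.2 ⟨ht₁T, fun h1 => ht₁pos.ne' (htight t₁ ht₁T h1)⟩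
      · rw [Finset.mem_filter, not_and, not_not]
        intro _
        rw [hval, hε, div_mul_cancel₀ _ ht₁pos.ne']; ring
    · rw [hval]
      rcases le_or_gt (h (t - v)) 0 with hle | hgt
      · nlinarith [hg t ht]
      · have := (le_div_iff₀ hgt).1 (hmin t (Finset.mem_filter.2 ⟨ht, hgt⟩))
        linarith

/-- A polytope of positive dimension has a face of codimension at most one avoiding a given
point of the polytope. -/
lemma exists_face_not_mem (T : Finset V) {v : V} (hv : v ∈ convexHull ℝ (T : Set V))
    (hpos : polyDim (convexHull ℝ (T : Set V)) ≠ 0) :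
    ∃ G, IsExposed ℝ (convexHull ℝ (T : Set V)) G ∧ v ∉ G ∧
      polyDim (convexHull ℝ (T : Set V)) ≤ polyDim G + 1 := by
  obtain ⟨g, hg, hspan⟩ := exists_functional_tight_span T v
  simp only [map_sub, sub_le_iff_le_add] at hg
  set U := Submodule.span ℝ ((· - v) '' {s | s ∈ T ∧ g (s - v) = 1}) with hU
  set G := {x | x ∈ convexHull ℝ (T : Set V) ∧ g x = 1 + g v} with hG
  have hspan' : vectorSpan ℝ (convexHull ℝ (T : Set V)) ≤ U := by
    rw [vectorSpan_eq_span_vsub_set_right ℝ hv, Submodule.span_le]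
    rintro _ ⟨x, hx, rfl⟩
    have hconv : Convex ℝ {y : V | y - v ∈ U} := by
      intro a ha b hb s t _ _ hst
      have : s • a + t • b - v = s • (a - v) + t • (b - v) := by
        have : v = (s + t) • v := by rw [hst, one_smul]
        nth_rewrite 1 [this]
        module
      change s • a + t • b - v ∈ U
      rw [this]
      exact U.add_mem (U.smul_mem _ ha) (U.smul_mem _ hb)
    exact convexHull_min (t := {y : V | y - v ∈ U}) hspan hconv hx
  have : FiniteDimensional ℝ U :=
    FiniteDimensional.span_of_finite ℝ ((T.finite_toSet.subset fun s hs => hs.1).image _)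
  have hle : polyDim (convexHull ℝ (T : Set V)) ≤ Module.finrank ℝ U :=
    Submodule.finrank_mono hspan'
  have hGsub : G ⊆ convexHull ℝ (T : Set V) := fun x hx => hx.1
  have hmemG : ∀ s ∈ T, g (s - v) = 1 → s ∈ G := fun s hs h1 =>
    ⟨subset_convexHull ℝ _ hs, by rw [map_sub] at h1; linarith⟩
  have hne : ∃ t₀ ∈ T, g (t₀ - v) = 1 := by
    by_contra hcon
    push Not at hcon
    have : U = ⊥ := by
      rw [hU, Submodule.span_eq_bot]
      rintro _ ⟨s, hs, rfl⟩
      exact absurd hs.2 (hcon s hs.1)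
    rw [this, finrank_bot] at hle
    exact hpos (Nat.le_zero.1 hle)
  obtain ⟨t₀, ht₀, ht₀1⟩ := hne
  refine ⟨G, isExposed_setOf_eq fun x hx => le_of_mem_convexHull hg hx,
    fun hvG => by linarith [hvG.2], hle.trans ?_⟩
  have := finiteDimensional_vectorSpan_convexHull T
  have : FiniteDimensional ℝ (vectorSpan ℝ G) :=
    Submodule.finiteDimensional_of_le (vectorSpan_mono ℝ hGsub)
  have hUle : U ≤ vectorSpan ℝ G ⊔ Submodule.span ℝ {t₀ - v} := by
    rw [hU, Submodule.span_le]
    rintro _ ⟨s, hs, rfl⟩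
    have : s - v = (s -ᵥ t₀) + (t₀ - v) := by rw [vsub_eq_sub]; abel
    change s - v ∈ _
    rw [this]
    exact Submodule.add_mem_sup (vsub_mem_vectorSpan ℝ (hmemG s hs.1 hs.2) (hmemG t₀ ht₀ ht₀1))
      (Submodule.mem_span_singleton_self _)
  calc Module.finrank ℝ U
      ≤ Module.finrank ℝ ↥(vectorSpan ℝ G ⊔ Submodule.span ℝ {t₀ - v}) :=
        Submodule.finrank_mono hUle
    _ ≤ Module.finrank ℝ (vectorSpan ℝ G) + Module.finrank ℝ (Submodule.span ℝ {t₀ - v}) :=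
        Submodule.finrank_add_le_finrank_add_finrank _ _
    _ ≤ polyDim G + 1 := by
        have : Module.finrank ℝ (Submodule.span ℝ {t₀ - v}) ≤ 1 := by
          simpa using finrank_span_le_card (R := ℝ) ({t₀ - v} : Set V)
        exact Nat.add_le_add_left this _

/-- The part of `E` in the flat through `v` and the points of `J`. -/
def coneFace (E : Set V) (v : V) (J : Finset V) : Set V :=
  {x | x ∈ E ∧ x - v ∈ Submodule.span ℝ ((· - v) '' (J : Set V))}

/-- `E` lies in the simplicial cone with apex `v ∈ E` spanned by the points of `S ⊆ E`. -/
structure IsSimplicialAt (E : Set V) (v : V) (S : Finset V) : Prop where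
  apex_mem : v ∈ E
  subset : (S : Set V) ⊆ E
  linearIndepOn : LinearIndepOn ℝ (· - v) (S : Set V)
  exists_coords : ∀ x ∈ E, ∃ a : V → ℝ, (∀ u ∈ S, 0 ≤ a u) ∧ x - v = ∑ u ∈ S, a u • (u - v)

lemma isSimplicialAt_of_slice {T S : Finset V} {v : V} {f : V →L[ℝ] ℝ} {c : ℝ}
    (hv : v ∈ convexHull ℝ (T : Set V)) (hc : c < f v) (hT : ∀ t ∈ T, t ≠ v → f t < c)
    (hS : AffineIndependent ℝ (fun x : {x // x ∈ S} => (x : V)))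
    (hslice : {x ∈ convexHull ℝ (T : Set V) | f x = c} = convexHull ℝ (S : Set V)) :
    IsSimplicialAt (convexHull ℝ (T : Set V)) v S := by
  classical
  have hSmem : ∀ u ∈ S, u ∈ convexHull ℝ (T : Set V) ∧ f u = c := fun u hu => by
    have : u ∈ convexHull ℝ (S : Set V) := subset_convexHull ℝ _ hu
    rwa [← hslice] at this
  refine ⟨hv, fun u hu => (hSmem u hu).1, ?_, ?_⟩
  · rw [linearIndepOn_finset_iff]
    intro a ha
    have hsum : ∑ u ∈ S, a u = 0 := by
      have h1 := congrArg f ha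
      rw [map_sum, map_zero] at h1
      have h2 : ∑ u ∈ S, f (a u • (u - v)) = (∑ u ∈ S, a u) * (c - f v) := by
        rw [Finset.sum_mul]
        refine Finset.sum_congr rfl fun u hu => ?_
        rw [map_smul, map_sub, (hSmem u hu).2, smul_eq_mul]
      rw [h2] at h1
      exact (mul_eq_zero.1 h1).resolve_right (by linarith)
    have hsum' : ∑ u ∈ S, a u • u = 0 := by
      simpa only [smul_sub, Finset.sum_sub_distrib, ← Finset.sum_smul, hsum, zero_smul,
        sub_zero] using ha
    intro u hu
    refine affineIndependent_iff.1 hS Finset.univ (fun u => a u) ?_ ?_ ⟨u, hu⟩ (Finset.mem_univ _)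
    · rw [← hsum]; exact Finset.sum_coe_sort S a
    · rw [← hsum']; exact Finset.sum_coe_sort S fun u => a u • u
  · intro x hx
    refine convexHull_min (t := {x | ∃ a : V → ℝ, (∀ u ∈ S, 0 ≤ a u) ∧
      x - v = ∑ u ∈ S, a u • (u - v)}) (fun t ht => ?_) ?_ hx
    · by_cases htv : t = v
      · exact ⟨0, fun _ _ => le_rfl, by simp [htv]⟩
      have hft := hT t ht htv
      set s := (f v - c) / (f v - f t) with hs
      have hs0 : 0 < s := div_pos (by linarith) (by linarith)
      have hs1 : s ≤ 1 := (div_le_one (by linarith)).2 (by linarith)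
      have hz : v + s • (t - v) ∈ convexHull ℝ (S : Set V) := by
        rw [← hslice]
        refine ⟨(convex_convexHull ℝ _).add_smul_sub_mem hv (subset_convexHull ℝ _ ht)
          ⟨hs0.le, hs1⟩, ?_⟩
        rw [map_add, map_smul, map_sub, smul_eq_mul, hs]
        have : f v - f t ≠ 0 := by linarith
        field_simp
        ring
      obtain ⟨w, hw0, hw1, hwz⟩ := Finset.mem_convexHull'.1 hz
      refine ⟨fun u => s⁻¹ * w u, fun u hu => mul_nonneg (inv_pos.2 hs0).le (hw0 u hu), ?_⟩
      have h1 : ∑ u ∈ S, w u • (u - v) = s • (t - v) := by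
        simp only [smul_sub, Finset.sum_sub_distrib, ← Finset.sum_smul, hw1, hwz, one_smul]
        abel
      simp only [mul_smul, ← Finset.smul_sum]
      rw [h1, smul_smul, inv_mul_cancel₀ hs0.ne', one_smul]
    · rintro x ⟨a, ha, hxa⟩ y ⟨b, hb, hyb⟩ s t hs ht hst
      refine ⟨fun u => s * a u + t * b u, fun u hu => add_nonneg (mul_nonneg hs (ha u hu))
        (mul_nonneg ht (hb u hu)), ?_⟩
      have : s • x + t • y - v = s • (x - v) + t • (y - v) := by
        have : v = (s + t) • v := by rw [hst, one_smul]
        nth_rewrite 1 [this]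
        module
      rw [this, hxa, hyb, Finset.smul_sum, Finset.smul_sum, ← Finset.sum_add_distrib]
      exact Finset.sum_congr rfl fun u _ => by module

namespace IsSimplicialAt

variable {E : Set V} {v : V} {S : Finset V}

lemma apex_mem_coneFace (h : IsSimplicialAt E v S) (J : Finset V) : v ∈ coneFace E v J :=
  ⟨h.apex_mem, by rw [sub_self]; exact Submodule.zero_mem _⟩

lemma mem_coneFace_of_mem (h : IsSimplicialAt E v S) {J : Finset V} (hJ : J ⊆ S) {u : V}
    (hu : u ∈ J) : u ∈ coneFace E v J :=
  ⟨h.subset (hJ hu), Submodule.subset_span ⟨u, hu, rfl⟩⟩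

lemma map_sub_apex_eq_zero {J : Finset V} {g : V →L[ℝ] ℝ} (hg : ∀ u ∈ J, g (u - v) = 0) {x : V}
    (hx : x ∈ coneFace E v J) : g (x - v) = 0 := by
  have : Submodule.span ℝ ((· - v) '' (J : Set V)) ≤ LinearMap.ker g.toLinearMap := by
    rw [Submodule.span_le]
    rintro _ ⟨u, hu, rfl⟩
    exact hg u hu
  exact this hx.2

/-- A functional maximal on `E` at `v` exposes the cone face spanned by its contact set. -/
lemma setOf_eq_coneFace (h : IsSimplicialAt E v S) {J : Finset V} {g : V →L[ℝ] ℝ}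
    (hg : ∀ u ∈ J, g (u - v) = 0) (hg' : ∀ u ∈ S, u ∉ J → g (u - v) < 0) :
    {x | x ∈ E ∧ g x = g v} = coneFace E v J := by
  classical
  refine Set.Subset.antisymm (fun x hx => ⟨hx.1, ?_⟩) fun x hx => ⟨hx.1, ?_⟩
  · obtain ⟨a, ha, hxa⟩ := h.exists_coords x hx.1
    have hnonpos : ∀ u ∈ S, a u * g (u - v) ≤ 0 := fun u hu => by
      by_cases huJ : u ∈ J
      · rw [hg u huJ, mul_zero]
      · exact mul_nonpos_of_nonneg_of_nonpos (ha u hu) (hg' u hu huJ).le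
    have hsum : ∑ u ∈ S, a u * g (u - v) = 0 := by
      have h1 := congrArg g hxa
      rw [map_sub, hx.2, sub_self, map_sum] at h1
      rw [h1]
      exact Finset.sum_congr rfl fun u _ => by rw [map_smul, smul_eq_mul]
    have hz := (Finset.sum_eq_zero_iff_of_nonpos hnonpos).1 hsum
    rw [hxa]
    refine Submodule.sum_mem _ fun u hu => ?_
    by_cases huJ : u ∈ J
    · exact Submodule.smul_mem _ _ (Submodule.subset_span ⟨u, huJ, rfl⟩)
    · rw [(mul_eq_zero.1 (hz u hu)).resolve_right (hg' u hu huJ).ne, zero_smul]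
      exact Submodule.zero_mem _
  · have := map_sub_apex_eq_zero hg hx
    rw [map_sub] at this
    linarith

lemma exists_exposing (h : IsSimplicialAt E v S) (J : Finset V) : ∃ g : V →L[ℝ] ℝ,
    ∀ u ∈ S, (u ∈ J → g (u - v) = 0) ∧ (u ∉ J → g (u - v) < 0) := by
  classical
  obtain ⟨g, hg⟩ := exists_continuousLinearMap_of_linearIndepOn h.linearIndepOn
    fun u => if u ∈ J then 0 else -1
  refine ⟨g, fun u hu => ⟨fun huJ => ?_, fun huJ => ?_⟩⟩
  · rw [hg u hu, if_pos huJ]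
  · rw [hg u hu, if_neg huJ]; norm_num

lemma isExposed_coneFace (h : IsSimplicialAt E v S) {J : Finset V} (hJ : J ⊆ S) :
    IsExposed ℝ E (coneFace E v J) := by
  obtain ⟨g, hg⟩ := h.exists_exposing J
  rw [← h.setOf_eq_coneFace (fun u hu => (hg u (hJ hu)).1 hu) fun u hu => (hg u hu).2]
  refine isExposed_setOf_eq fun x hx => ?_
  obtain ⟨a, ha, hxa⟩ := h.exists_coords x hx
  have h1 := congrArg g hxa
  rw [map_sub, map_sum] at h1
  have h2 : ∑ u ∈ S, g (a u • (u - v)) ≤ 0 := Finset.sum_nonpos fun u hu => by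
    rw [map_smul, smul_eq_mul]
    refine mul_nonpos_of_nonneg_of_nonpos (ha u hu) ?_
    by_cases huJ : u ∈ J
    · exact ((hg u hu).1 huJ).le
    · exact ((hg u hu).2 huJ).le
  linarith

lemma exists_eq_coneFace (h : IsSimplicialAt E v S) {F : Set V} (hF : IsExposed ℝ E F)
    (hv : v ∈ F) : ∃ J ⊆ S, F = coneFace E v J := by
  classical
  obtain ⟨g, hg, hFg⟩ := hF.exists_max hv
  refine ⟨S.filter fun u => g (u - v) = 0, Finset.filter_subset _ _, ?_⟩
  rw [hFg]
  refine h.setOf_eq_coneFace (fun u hu => (Finset.mem_filter.1 hu).2)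
    fun u hu huJ => lt_of_le_of_ne ?_ fun h0 => huJ (Finset.mem_filter.2 ⟨hu, h0⟩)
  rw [map_sub]
  linarith [hg u (h.subset hu)]

lemma coneFace_injOn (h : IsSimplicialAt E v S) :
    Set.InjOn (coneFace E v) (S.powerset : Set (Finset V)) := by
  have key : ∀ J ⊆ S, ∀ K ⊆ S, coneFace E v J = coneFace E v K → J ⊆ K := by
    intro J hJ K hK hJK u hu
    by_contra huK
    obtain ⟨g, hg⟩ := h.exists_exposing K
    have huF : u ∈ coneFace E v K := hJK ▸ h.mem_coneFace_of_mem hJ hu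
    exact ((hg u (hJ hu)).2 huK).ne
      (map_sub_apex_eq_zero (fun w hw => (hg w (hK hw)).1 hw) huF)
  intro J hJ K hK hJK
  have hJ' := Finset.mem_powerset.1 (Finset.mem_coe.1 hJ)
  have hK' := Finset.mem_powerset.1 (Finset.mem_coe.1 hK)
  exact (key J hJ' K hK' hJK).antisymm (key K hK' J hJ' hJK.symm)

lemma polyDim_coneFace (h : IsSimplicialAt E v S) {J : Finset V} (hJ : J ⊆ S) :
    polyDim (coneFace E v J) = J.card := by
  classical
  have hspan : vectorSpan ℝ (coneFace E v J) = Submodule.span ℝ ((· - v) '' (J : Set V)) := by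
    rw [vectorSpan_eq_span_vsub_set_right ℝ (h.apex_mem_coneFace J)]
    refine le_antisymm (Submodule.span_le.2 ?_) (Submodule.span_mono ?_)
    · rintro _ ⟨x, hx, rfl⟩
      exact hx.2
    · rintro _ ⟨u, hu, rfl⟩
      exact ⟨u, h.mem_coneFace_of_mem hJ hu, rfl⟩
  have hli : LinearIndependent ℝ fun u : (J : Set V) => (u : V) - v :=
    h.linearIndepOn.mono (Finset.coe_subset.2 hJ)
  rw [polyDim, hspan, Set.image_eq_range]
  exact (finrank_span_eq_card hli).trans (by simp)

lemma coneFace_self (h : IsSimplicialAt E v S) : coneFace E v S = E := by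
  refine Set.Subset.antisymm (fun x hx => hx.1) fun x hx => ⟨hx, ?_⟩
  obtain ⟨a, -, hxa⟩ := h.exists_coords x hx
  rw [hxa]
  exact Submodule.sum_mem _ fun u hu =>
    Submodule.smul_mem _ _ (Submodule.subset_span ⟨u, hu, rfl⟩)

lemma polyDim_eq_card (h : IsSimplicialAt E v S) : polyDim E = S.card := by
  rw [← h.polyDim_coneFace subset_rfl, h.coneFace_self]

/-- There are `(#S).choose k` faces of dimension `k` at a simplicial apex. -/
lemma ncard_faces (h : IsSimplicialAt E v S) (k : ℕ) :
    {F | IsExposed ℝ E F ∧ v ∈ F ∧ polyDim F = k}.Finite ∧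
      {F | IsExposed ℝ E F ∧ v ∈ F ∧ polyDim F = k}.ncard = S.card.choose k := by
  have hinj : Set.InjOn (coneFace E v) (S.powersetCard k : Set (Finset V)) :=
    h.coneFace_injOn.mono fun J hJ => Finset.mem_coe.2
      (Finset.mem_powerset.2 (Finset.mem_powersetCard.1 (Finset.mem_coe.1 hJ)).1)
  have : {F | IsExposed ℝ E F ∧ v ∈ F ∧ polyDim F = k} =
      coneFace E v '' (S.powersetCard k : Set (Finset V)) := by
    ext F
    constructor
    · rintro ⟨hF, hv, hk⟩
      obtain ⟨J, hJ, rfl⟩ := h.exists_eq_coneFace hF hv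
      exact ⟨J, Finset.mem_coe.2 (Finset.mem_powersetCard.2
        ⟨hJ, (h.polyDim_coneFace hJ).symm.trans hk⟩), rfl⟩
    · rintro ⟨J, hJ, rfl⟩
      obtain ⟨hJS, hJk⟩ := Finset.mem_powersetCard.1 (Finset.mem_coe.1 hJ)
      exact ⟨h.isExposed_coneFace hJS, h.apex_mem_coneFace J,
        (h.polyDim_coneFace hJS).trans hJk⟩
  rw [this]
  refine ⟨(Finset.finite_toSet _).image _, ?_⟩
  rw [hinj.ncard_image, Set.ncard_coe_finset, Finset.card_powersetCard]

end IsSimplicialAt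

lemma polyDim_simplex_add_one {S : Finset V} (hne : S.Nonempty)
    (hS : AffineIndependent ℝ (fun x : {x // x ∈ S} => (x : V))) :
    polyDim (convexHull ℝ (S : Set V)) + 1 = S.card := by
  have : Nonempty {x // x ∈ S} := hne.to_subtype
  have h1 := hS.finrank_vectorSpan_add_one
  rw [polyDim, ← direction_affineSpan, affineSpan_convexHull, direction_affineSpan]
  rw [Subtype.range_coe_subtype, Fintype.card_coe] at h1
  exact h1

namespace ConicSeq

lemma mem_cpx_pred_iff {W : Type*} {K : Set (Set W)} {ℓ : ℕ} (cs : ConicSeq K ℓ) {i : ℕ}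
    (h2 : 2 ≤ i) (hi : i ≤ ℓ) {F : Set W} : F ∈ cs.cpx (i - 1) ↔ F ∈ cs.cpx i ∧ cs.v i ∉ F := by
  rw [cs.step i h2 hi]
  exact ⟨fun h => ⟨h.1, fun hv => h.2 ⟨h.1, hv, cs.E_greatest i h2 hi F h.1 hv⟩⟩,
    fun h => ⟨h.1, fun hF => h.2 hF.2.1⟩⟩

/-- The `i`-th complex consists of the cells avoiding all the vertices removed before. -/
lemma mem_cpx_iff {W : Type*} {K : Set (Set W)} {ℓ : ℕ} (cs : ConicSeq K ℓ) {i : ℕ} (h1 : 1 ≤ i)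
    (hi : i ≤ ℓ) {F : Set W} :
    F ∈ cs.cpx i ↔ F ∈ K ∧ ∀ j, i < j → j ≤ ℓ → cs.v j ∉ F := by
  induction hi using Nat.decreasingInduction with
  | self =>
    rw [cs.top]
    exact ⟨fun h => ⟨h, fun j hj hj' => absurd hj hj'.not_gt⟩, fun h => h.1⟩
  | of_succ i hi ih =>
    have hpred := cs.mem_cpx_pred_iff (F := F) (i := i + 1) (by omega) hi
    rw [Nat.add_sub_cancel] at hpred
    rw [hpred, ih (by omega)]
    refine ⟨fun h => ⟨h.1.1, fun j hj hj' => ?_⟩, fun h => ⟨⟨h.1, fun j hj => h.2 j (by omega)⟩,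
      h.2 _ (by omega) hi⟩⟩
    rcases Nat.lt_or_ge (i + 1) j with hlt | hge
    · exact h.1.2 j hlt hj'
    · obtain rfl : j = i + 1 := by omega
      exact h.2

variable {S : Finset V} {ℓ : ℕ} (cs : ConicSeq (faces (convexHull ℝ (S : Set V))) ℓ)

lemma isExposed_of_mem_cpx {i : ℕ} (h1 : 1 ≤ i) (hi : i ≤ ℓ) {F : Set V} (hF : F ∈ cs.cpx i) :
    IsExposed ℝ (convexHull ℝ (S : Set V)) F :=
  ((cs.mem_cpx_iff h1 hi).1 hF).1

lemma mem_cpx_of_isExposed {i : ℕ} (h1 : 1 ≤ i) (hi : i ≤ ℓ) {E F : Set V} (hE : E ∈ cs.cpx i)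
    (hF : IsExposed ℝ E F) : F ∈ cs.cpx i :=
  (cs.mem_cpx_iff h1 hi).2 ⟨(cs.isExposed_of_mem_cpx h1 hi hE).trans_of_convexHull hF,
    fun j hj hj' hv => ((cs.mem_cpx_iff h1 hi).1 hE).2 j hj hj' (hF.subset hv)⟩

lemma exists_cone_generators {i : ℕ} (h2 : 2 ≤ i) (hi : i ≤ ℓ) : ∃ T : Finset V,
    T ⊆ S ∧ cs.E i = convexHull ℝ (T : Set V) := by
  classical
  refine ⟨S.filter (· ∈ cs.E i), Finset.filter_subset _ _, ?_⟩
  rw [Finset.coe_filter]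
  exact (cs.isExposed_of_mem_cpx (by omega) hi (cs.E_mem i h2 hi)).eq_convexHull_s3
    ⟨_, cs.v_mem_E i h2 hi⟩

lemma exists_isSimplicialAt (hS : ∀ s ∈ S, IsExposed ℝ (convexHull ℝ (S : Set V)) {s})
    {C : ℕ → Set V} (hC : cs.HasSlices C) {i : ℕ} (h2 : 2 ≤ i) (hi : i ≤ ℓ)
    (hΔ : IsSimplex (C i)) :
    ∃ D : Finset V, IsSimplicialAt (cs.E i) (cs.v i) D ∧ polyDim (C i) + 1 = D.card := by
  obtain ⟨D, hDne, hD, hCD⟩ := hΔ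
  obtain ⟨f, c, hc, hlt, hslice⟩ := hC i h2 hi
  obtain ⟨T, hTS, hET⟩ := cs.exists_cone_generators h2 hi
  refine ⟨D, ?_, hCD ▸ polyDim_simplex_add_one hDne hD⟩
  have hvE := cs.v_mem_E i h2 hi
  have hTE : ∀ t ∈ T, t ∈ cs.E i := fun t ht => hET ▸ subset_convexHull ℝ _ ht
  rw [hCD, hET] at hslice
  rw [hET] at hvE ⊢
  refine isSimplicialAt_of_slice hvE hc (fun t ht htv => hlt t ⟨⟨{t}, ?_, rfl⟩, hTE t ht⟩) hD
    hslice.symm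
  refine (cs.mem_cpx_pred_iff h2 hi).2 ⟨(cs.mem_cpx_iff (by omega) hi).2
    ⟨hS t (hTS ht), fun j hj hj' hv => ?_⟩, fun hv => htv (Set.mem_singleton_iff.1 hv).symm⟩
  refine ((cs.mem_cpx_iff (by omega) hi).1 (cs.E_mem i h2 hi)).2 j hj hj' ?_
  rw [Set.mem_singleton_iff.1 hv]
  exact hTE t ht

lemma interval_eq {i : ℕ} (h2 : 2 ≤ i) (hi : i ≤ ℓ) :
    {F | F ∈ cs.cpx i ∧ cs.v i ∈ F} = {F | IsExposed ℝ (cs.E i) F ∧ cs.v i ∈ F} := by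
  have hE := cs.E_mem i h2 hi
  ext F
  exact ⟨fun h => ⟨(cs.isExposed_of_mem_cpx (by omega) hi h.1).mono
      (cs.isExposed_of_mem_cpx (by omega) hi hE).subset (cs.E_greatest i h2 hi F h.1 h.2), h.2⟩,
    fun h => ⟨cs.mem_cpx_of_isExposed (by omega) hi hE h.1, h.2⟩⟩

/-- Face numbers of the complexes of a conic sequence whose cones are simplicial. -/
lemma ncard_cpx {d : ℕ → ℕ}
    (hd : ∀ i, 2 ≤ i → i ≤ ℓ → ∃ D : Finset V, IsSimplicialAt (cs.E i) (cs.v i) D ∧ d i = D.card)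
    (k : ℕ) {i : ℕ} (h1 : 1 ≤ i) (hi : i ≤ ℓ) :
    {F | F ∈ cs.cpx i ∧ F.Nonempty ∧ polyDim F = k}.Finite ∧
      {F | F ∈ cs.cpx i ∧ F.Nonempty ∧ polyDim F = k}.ncard =
        (if k = 0 then 1 else 0) + ∑ j ∈ Finset.Icc 2 i, (d j).choose k := by
  induction i, h1 using Nat.le_induction with
  | base =>
    have : {F | F ∈ cs.cpx 1 ∧ F.Nonempty ∧ polyDim F = k} =
        if k = 0 then {{cs.v 1}} else ∅ := by
      rw [cs.bottom]
      ext F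
      split_ifs with hk
      · subst hk
        constructor
        · rintro ⟨rfl | rfl, hne, -⟩
          · exact absurd hne Set.not_nonempty_empty
          · rfl
        · rintro rfl
          exact ⟨Or.inr rfl, Set.singleton_nonempty _, polyDim_singleton_s3 _⟩
      · refine ⟨?_, fun h => h.elim⟩
        rintro ⟨rfl | rfl, hne, hF⟩
        · exact absurd hne Set.not_nonempty_empty
        · exact hk (hF.symm.trans (polyDim_singleton_s3 _))
    rw [this]
    split_ifs <;> simp
  | succ i h1 ih =>
    obtain ⟨ihf, ihc⟩ := ih (by omega)
    obtain ⟨D, hD, hdD⟩ := hd (i + 1) (by omega) hi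
    obtain ⟨hf, hc⟩ := hD.ncard_faces k
    have hpred : ∀ F, F ∈ cs.cpx i ↔ F ∈ cs.cpx (i + 1) ∧ cs.v (i + 1) ∉ F := fun F =>
      cs.mem_cpx_pred_iff (F := F) (i := i + 1) (by omega) hi
    have hint : ∀ F, F ∈ cs.cpx (i + 1) ∧ cs.v (i + 1) ∈ F ↔
        IsExposed ℝ (cs.E (i + 1)) F ∧ cs.v (i + 1) ∈ F := fun F =>
      Set.ext_iff.1 (cs.interval_eq (i := i + 1) (by omega) hi) F
    have hunion : {F | F ∈ cs.cpx (i + 1) ∧ F.Nonempty ∧ polyDim F = k} =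
        {F | F ∈ cs.cpx i ∧ F.Nonempty ∧ polyDim F = k} ∪
          {F | IsExposed ℝ (cs.E (i + 1)) F ∧ cs.v (i + 1) ∈ F ∧ polyDim F = k} := by
      ext F
      constructor
      · rintro ⟨hF, hne, hk⟩
        by_cases hv : cs.v (i + 1) ∈ F
        · exact Or.inr ⟨((hint F).1 ⟨hF, hv⟩).1, hv, hk⟩
        · exact Or.inl ⟨(hpred F).2 ⟨hF, hv⟩, hne, hk⟩
      · rintro (⟨hF, hne, hk⟩ | ⟨hF, hv, hk⟩)
        · exact ⟨((hpred F).1 hF).1, hne, hk⟩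
        · exact ⟨((hint F).2 ⟨hF, hv⟩).1, ⟨_, hv⟩, hk⟩
    have hdisj : Disjoint {F | F ∈ cs.cpx i ∧ F.Nonempty ∧ polyDim F = k}
        {F | IsExposed ℝ (cs.E (i + 1)) F ∧ cs.v (i + 1) ∈ F ∧ polyDim F = k} :=
      Set.disjoint_left.2 fun F hF hF' => ((hpred F).1 hF.1).2 hF'.2.1
    rw [hunion]
    refine ⟨ihf.union hf, ?_⟩
    rw [Set.ncard_union_eq hdisj ihf hf, ihc, hc, Finset.sum_Icc_succ_top (by omega), hdD]
    ring

/-- Every positive dimension up to that of a cell occurs as the dimension of some `E j`. -/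
lemma exists_polyDim_E_eq {i : ℕ} (h1 : 1 ≤ i) (hi : i ≤ ℓ) {F : Set V} (hF : F ∈ cs.cpx i)
    {k : ℕ} (hk : 1 ≤ k) (hkF : k ≤ polyDim F) : ∃ j ∈ Finset.Icc 2 ℓ, polyDim (cs.E j) = k := by
  induction i, h1 using Nat.le_induction generalizing F with
  | base =>
    rw [cs.bottom] at hF
    rcases hF with rfl | rfl
    · rw [polyDim_empty] at hkF; omega
    · rw [polyDim_singleton_s3] at hkF; omega
  | succ i h1 ih =>
    have hpred : ∀ F, F ∈ cs.cpx i ↔ F ∈ cs.cpx (i + 1) ∧ cs.v (i + 1) ∉ F := fun F =>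
      cs.mem_cpx_pred_iff (F := F) (i := i + 1) (by omega) hi
    by_cases hv : cs.v (i + 1) ∈ F
    · obtain ⟨T, -, hT⟩ := cs.exists_cone_generators (i := i + 1) (by omega) hi
      have hE := cs.E_mem (i + 1) (by omega) hi
      have hvE := cs.v_mem_E (i + 1) (by omega) hi
      have hFE := cs.E_greatest (i + 1) (by omega) hi F hF hv
      have hkE : k ≤ polyDim (cs.E (i + 1)) := by
        rw [hT] at hFE ⊢
        exact hkF.trans (polyDim_mono hFE)
      rcases hkE.eq_or_lt with heq | hlt
      · exact ⟨i + 1, Finset.mem_Icc.2 ⟨by omega, hi⟩, heq.symm⟩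
      · have hG : ∃ G, IsExposed ℝ (cs.E (i + 1)) G ∧ cs.v (i + 1) ∉ G ∧
            polyDim (cs.E (i + 1)) ≤ polyDim G + 1 := by
          rw [hT] at hvE hlt ⊢
          exact exists_face_not_mem T hvE (by omega)
        obtain ⟨G, hGE, hvG, hdim⟩ := hG
        exact ih (by omega)
          ((hpred G).2 ⟨cs.mem_cpx_of_isExposed (by omega) hi hE hGE, hvG⟩) (by omega)
    · exact ih (by omega) ((hpred F).2 ⟨hF, hv⟩) hkF

end ConicSeq

open Polynomial in
/-- Comparison of coefficients between the `f`- and `h`-polynomials. -/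
lemma coeff_eq_of_sum_choose {ι : Type*} (s : Finset ι) (d : ι → ℕ) (n : ℕ)
    (hd : ∀ i ∈ s, d i ≤ n) (f : ℕ → ℕ)
    (hf : ∀ k, f k = (if k = 0 then 1 else 0) + ∑ i ∈ s, (d i).choose k) (h : ℕ → ℤ)
    (hh : ∑ k ∈ Finset.range (n + 1), C (f k : ℚ) * X ^ k =
      ∑ k ∈ Finset.range (n + 1), C (h k : ℚ) * (X + 1) ^ k) {k : ℕ} (hk : k ≤ n) :
    h k = (if k = 0 then 1 else 0) + ((s.filter fun i => d i = k).card : ℤ) := by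
  have hfX : ∑ k ∈ Finset.range (n + 1), C (f k : ℚ) * X ^ k =
      1 + ∑ i ∈ s, (X + 1 : ℚ[X]) ^ d i := by
    have hpow : ∀ i ∈ s, (X + 1 : ℚ[X]) ^ d i =
        ∑ k ∈ Finset.range (n + 1), C ((d i).choose k : ℚ) * X ^ k := by
      intro i hi
      rw [add_pow]
      refine (Finset.sum_subset_zero_on_sdiff
        (Finset.range_subset_range.2 (Nat.succ_le_succ (hd i hi))) (fun k hk => ?_)
        fun k _ => ?_)
      · rw [Finset.mem_sdiff, Finset.mem_range, Finset.mem_range] at hk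
        rw [Nat.choose_eq_zero_of_lt (by omega)]
        simp
      · rw [one_pow, mul_one, mul_comm, map_natCast]
    rw [Finset.sum_congr rfl hpow, Finset.sum_comm]
    simp only [hf, Nat.cast_add, Nat.cast_sum, map_add, map_sum, add_mul, Finset.sum_mul,
      Finset.sum_add_distrib]
    congr 1
    rw [Finset.sum_eq_single_of_mem 0 (by simp) fun k _ hk => by simp [hk]]
    simp
  have hcomp := congrArg (fun p : ℚ[X] => p.comp (X - 1)) (hh.symm.trans hfX)
  simp only [Polynomial.sum_comp, mul_comp, pow_comp, add_comp, X_comp, one_comp, C_comp,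
    sub_add_cancel] at hcomp
  have hcoeff := congrArg (fun p : ℚ[X] => p.coeff k) hcomp
  simp only [finsetSum_coeff, coeff_add, coeff_C_mul_X_pow, coeff_X_pow, coeff_one] at hcoeff
  rw [Finset.sum_ite_eq, if_pos (Finset.mem_range.2 (by omega)), Finset.sum_boole] at hcoeff
  have hset : s.filter (fun i => k = d i) = s.filter fun i => d i = k :=
    Finset.filter_congr fun i _ => eq_comm
  rw [hset] at hcoeff
  have : (h k : ℚ) =
      (((if k = 0 then 1 else 0) + ((s.filter fun i => d i = k).card : ℤ) : ℤ) : ℚ) := by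
    rw [hcoeff]; push_cast; rfl
  exact_mod_cast this

/-- **Corollary 2.8.** Let `P` be an `n`-dimensional convex polytope admitting a Δ-conic
sequence with corresponding sequence of simplices `𝒞 = {C_2, …, C_ℓ}`, and define integers
`h_0, …, h_n` by `∑_{k=0}^n f_k(P) x^k = ∑_{k=0}^n h_k (x+1)^k`. Then `h_0 = 1`; for
`1 ≤ k ≤ n`, `h_k` is the number of `(k-1)`-dimensional simplices among `C_2, …, C_ℓ`; and
`h_k ≥ 1` for all `1 ≤ k ≤ n`. -/
theorem delta_conic_h_vector
    {V : Type*} [NormedAddCommGroup V] [NormedSpace ℝ V]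
    (P : Set V) (hP : IsPolytope P) (n : ℕ) (hn : polyDim P = n)
    (ℓ : ℕ) (cs : ConicSeq (faces P) ℓ) (C : ℕ → Set V) (hC : cs.HasSlices C)
    (hΔ : ∀ i, 2 ≤ i → i ≤ ℓ → IsSimplex (C i))
    (h : ℕ → ℤ)
    (hh : ∑ k ∈ Finset.range (n + 1), Polynomial.C ((faceCount P k : ℚ)) * Polynomial.X ^ k
        = ∑ k ∈ Finset.range (n + 1), Polynomial.C ((h k : ℚ)) * (Polynomial.X + 1) ^ k) :
    h 0 = 1 ∧
    (∀ k, 1 ≤ k → k ≤ n →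
      h k = Nat.card {i : ℕ // i ∈ Finset.Icc 2 ℓ ∧ polyDim (C i) + 1 = k}) ∧
    (∀ k, 1 ≤ k → k ≤ n → 1 ≤ h k) := by
  classical
  obtain ⟨S, rfl, hS⟩ : ∃ S : Finset V, P = convexHull ℝ (S : Set V) ∧
      ∀ s ∈ S, IsExposed ℝ (convexHull ℝ (S : Set V)) {s} := by
    obtain ⟨S₀, rfl⟩ := hP
    exact exists_exposed_generators S₀
  have hd : ∀ i, 2 ≤ i → i ≤ ℓ → ∃ D : Finset V, IsSimplicialAt (cs.E i) (cs.v i) D ∧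
      polyDim (C i) + 1 = D.card := fun i h2 hi =>
    cs.exists_isSimplicialAt hS hC h2 hi (hΔ i h2 hi)
  have hdim : ∀ i, 2 ≤ i → i ≤ ℓ → polyDim (C i) + 1 = polyDim (cs.E i) := fun i h2 hi => by
    obtain ⟨D, hD, hDC⟩ := hd i h2 hi
    rw [hDC, hD.polyDim_eq_card]
  have hle : ∀ i ∈ Finset.Icc 2 ℓ, polyDim (C i) + 1 ≤ n := fun i hi => by
    obtain ⟨h2, hi⟩ := Finset.mem_Icc.1 hi
    rw [hdim i h2 hi, ← hn]
    exact polyDim_mono (cs.isExposed_of_mem_cpx (by omega) hi (cs.E_mem i h2 hi)).subset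
  have hf : ∀ k, faceCount (convexHull ℝ (S : Set V)) k =
      (if k = 0 then 1 else 0) + ∑ i ∈ Finset.Icc 2 ℓ, (polyDim (C i) + 1).choose k := fun k => by
    rw [← (cs.ncard_cpx hd k cs.one_le le_rfl).2, cs.top, ← Nat.card_coe_set_eq]
    rfl
  have hcoeff : ∀ k ≤ n, h k = (if k = 0 then 1 else 0) +
      (((Finset.Icc 2 ℓ).filter fun i => polyDim (C i) + 1 = k).card : ℤ) := fun k hk =>
    coeff_eq_of_sum_choose _ (fun i => polyDim (C i) + 1) n hle _ hf h hh hk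
  refine ⟨?_, fun k hk hkn => ?_, fun k hk hkn => ?_⟩
  · rw [hcoeff 0 (Nat.zero_le _)]
    simp
  · rw [hcoeff k hkn, if_neg (by omega), zero_add, Nat.cast_inj]
    exact (Nat.subtype_card _ fun i => Finset.mem_filter).symm
  · rw [hcoeff k hkn, if_neg (by omega), zero_add]
    have hP : convexHull ℝ (S : Set V) ∈ cs.cpx ℓ := by
      rw [cs.top]
      exact IsExposed.refl _
    obtain ⟨j, hj, hjk⟩ := cs.exists_polyDim_E_eq cs.one_le le_rfl hP hk (hn ▸ hkn)
    have hpos : 0 < ((Finset.Icc 2 ℓ).filter fun i => polyDim (C i) + 1 = k).card := by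
      refine Finset.card_pos.2 ⟨j, Finset.mem_filter.2 ⟨hj, ?_⟩⟩
      obtain ⟨h2, hjl⟩ := Finset.mem_Icc.1 hj
      rw [hdim j h2 hjl, hjk]
    exact_mod_cast hpos
end
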